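/- There exists a constant C₀ ≥ 20 such that for every C ≥ C₀ and all sufficiently large N the following holds. Let (X, Y) ~ D, where Y ∈ {±1}^N denotes the last N coordinates, and let δ = N^{−1/3}. Then with probability at least 1 − 5·N^{−2}: (1−δ)·N/2 ≤ |{ i ∈ [N] : Y_i = 1 }| ≤ (1+δ)·N/2. -/

import Mathlib

open MeasureTheory ProbabilityTheory Finset

noncomputable section

/-- Bit strings of length `n`; there are `N = 2^n` of them. -/
abbrev BV (n : ℕ) := Fin n → Bool

/-- Inner product (mod nothing, just the count) of two bit strings. -/
def bip {n : ℕ} (x y : BV n) : ℕ := (Finset.univ.filter fun i => x i && y i).card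

/-- The `N × N` normalized Walsh-Hadamard matrix, `H_{x,y} = (-1)^{⟨x,y⟩} / √N`. -/
def Had (n : ℕ) : Matrix (BV n) (BV n) ℝ :=
  Matrix.of fun x y => (-1 : ℝ) ^ bip x y / Real.sqrt (2 ^ n)

/-- `ε = 1 / (C ln N)` with `N = 2^n`. -/
def eps (C : ℝ) (n : ℕ) : ℝ := 1 / (C * Real.log (2 ^ n))

/-- The Gaussian vector `X` with i.i.d. `N(0, ε)` coordinates. -/
def gaussVec (C : ℝ) (n : ℕ) : Measure (BV n → ℝ) :=
  Measure.pi fun _ => gaussianReal 0 (eps C n).toNNReal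

/-- The distribution `G'` of `Z = (X, Y∘Y - ε·𝟙)` with `Y = H·X`, packed as a
function on `BV n ⊕ BV n` (first `N` coordinates are `X`, last `N` are `Y∘Y - ε`). -/
def Gmeas' (C : ℝ) (n : ℕ) : Measure (BV n ⊕ BV n → ℝ) :=
  (gaussVec C n).map fun X => Sum.elim X fun i => ((Had n).mulVec X i) ^ 2 - eps C n

/-- Truncation to `[-1, 1]`. -/
def trnc (a : ℝ) : ℝ := min 1 (max (-1) a)

/-- Randomized rounding of `a` to `±1`: output `1` with probability `(1 + trnc a)/2`
and `-1` with probability `(1 - trnc a)/2`. -/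
def roundM (a : ℝ) : Measure ℝ :=
  ((1 + trnc a) / 2).toNNReal • Measure.dirac 1 +
    ((1 - trnc a) / 2).toNNReal • Measure.dirac (-1)

/-- The distribution `D` on `{±1}^{2N}`: sample `z ~ G'` and round each coordinate
independently. -/
def Dmeas (C : ℝ) (n : ℕ) : Measure (BV n ⊕ BV n → ℝ) :=
  (Gmeas' C n).bind fun z => Measure.pi fun i => roundM (z i)

/-- `F : ℝ^ι → ℝ` is multilinear if `F z = Σ_S F̂(S) ∏_{i ∈ S} z_i`. -/
def IsMultilinear {ι : Type*} [Fintype ι] [DecidableEq ι] (F : (ι → ℝ) → ℝ) : Prop :=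
  ∃ c : Finset ι → ℝ, ∀ z, F z = ∑ S : Finset ι, c S * ∏ i ∈ S, z i

/-- The Fourier coefficient `F̂(S)` of `F` (over the hypercube `{±1}^ι`); for a
multilinear `F` these are precisely its multilinear coefficients. -/
def mlCoeff {ι : Type*} [Fintype ι] [DecidableEq ι] (F : (ι → ℝ) → ℝ) (S : Finset ι) : ℝ :=
  (∑ z : ι → Bool, F (fun i => if z i then 1 else -1) * ∏ i ∈ S, (if z i then (1 : ℝ) else -1)) /
    2 ^ Fintype.card ι

/-- `L_{1,2}(F) = Σ_{|S| = 2} |F̂(S)|`. -/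
def L12 {ι : Type*} [Fintype ι] [DecidableEq ι] (F : (ι → ℝ) → ℝ) : ℝ :=
  ∑ S ∈ Finset.univ.filter (fun S : Finset ι => S.card = 2), |mlCoeff F S|

/-- The restriction `F_ρ` of `F` under `ρ = (S, w)`: coordinates outside `S` are
fixed to the values of `w`. -/
def restrictML {ι : Type*} [DecidableEq ι] (F : (ι → ℝ) → ℝ) (S : Finset ι)
    (w : ι → ℝ) : (ι → ℝ) → ℝ :=
  fun y => F fun i => if i ∈ S then y i else w i

/-- `φ(X, Y) = (1/N) Σ_i (Σ_j H_{ij} X_j)² Y_i`. -/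
def phi (n : ℕ) (X Y : BV n → ℝ) : ℝ :=
  (∑ i, ((Had n).mulVec X i) ^ 2 * Y i) / 2 ^ n

/-- The multilinear part `φ_{i≠j}(X, Y) = (1/N) Σ_i Σ_{j ≠ k} H_{ij} H_{ik} X_j X_k Y_i`. -/
def phiOff (n : ℕ) (X Y : BV n → ℝ) : ℝ :=
  (∑ i, ∑ j, ∑ k ∈ Finset.univ \ {j}, Had n i j * Had n i k * X j * X k * Y i) / 2 ^ n

/-- The Fourier coefficient `f̂(x) = 2^{-n} Σ_y f(y) (-1)^{⟨x,y⟩}` of `f : {0,1}^n → {±1}`. -/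
def hatF (n : ℕ) (f : BV n → ℝ) (x : BV n) : ℝ :=
  (∑ y, f y * (-1 : ℝ) ^ bip x y) / 2 ^ n

/-- A product of independent factors integrates to the product of the integrals. -/
lemma lintegral_pi_prod {ι : Type*} [Fintype ι] (μ : ι → Measure ℝ)
    [∀ i, IsProbabilityMeasure (μ i)] (f : ι → ℝ → ENNReal) (hf : ∀ i, Measurable (f i)) :
    ∫⁻ x, ∏ i, f i (x i) ∂(Measure.pi μ) = ∏ i, ∫⁻ x, f i x ∂(μ i) := by
  have h := lintegral_prod_eq_prod_lintegral_of_indepFun (μ := Measure.pi μ) Finset.univ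
    (fun i x => f i (x i)) (iIndepFun_pi fun i => (hf i).aemeasurable)
    (fun i => (hf i).comp (measurable_pi_apply i))
  rw [h]
  refine Finset.prod_congr rfl fun i _ => ?_
  rw [← (measurePreserving_eval μ i).map_eq, lintegral_map (hf i) (measurable_pi_apply i)]

/-- An orthogonal matrix preserves the law of a vector of i.i.d. centred Gaussians. -/
lemma map_mulVec_pi_gaussianReal {ι : Type*} [Fintype ι] [DecidableEq ι] (A : Matrix ι ι ℝ)
    (hA : A * A.transpose = 1) (v : NNReal) :
    (Measure.pi fun _ : ι => gaussianReal 0 v).map A.mulVec =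
      Measure.pi fun _ : ι => gaussianReal 0 v := by
  have hm : Measurable A.mulVec := by
    have : Continuous A.mulVec := continuous_const.matrix_mulVec continuous_id
    exact this.measurable
  have : IsProbabilityMeasure ((Measure.pi fun _ : ι => gaussianReal 0 v).map A.mulVec) :=
    Measure.isProbabilityMeasure_map hm.aemeasurable
  rw [← charFun_eq_pi_iff]
  intro t
  have h1 : charFun (((Measure.pi fun _ : ι => gaussianReal 0 v).map A.mulVec).map
      (WithLp.toLp 2)) t = charFun ((Measure.pi fun _ : ι => gaussianReal 0 v).map (WithLp.toLp 2))
        (WithLp.toLp 2 (A.transpose.mulVec t.ofLp)) := by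
    simp only [charFun]
    simp_rw [← MeasurableEquiv.coe_toLp, integral_map_equiv]
    rw [integral_map hm.aemeasurable]
    · congr 1
      ext x
      congr 3
      simp only [PiLp.inner_apply, MeasurableEquiv.coe_toLp]
      have := Matrix.dotProduct_mulVec t.ofLp A x
      rw [Matrix.mulVec_transpose]
      simpa [dotProduct] using this
    · simp only [PiLp.inner_apply, MeasurableEquiv.coe_toLp]
      refine Continuous.aestronglyMeasurable ?_
      fun_prop
  rw [h1, charFun_pi]
  simp_rw [charFun_gaussianReal]
  rw [← Complex.exp_sum, ← Complex.exp_sum]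
  congr 1
  have h2 : ∑ i, (A.transpose.mulVec t.ofLp i) ^ 2 = ∑ i, (t.ofLp i) ^ 2 := by
    have : (A.transpose.mulVec t.ofLp) ⬝ᵥ (A.transpose.mulVec t.ofLp) = t.ofLp ⬝ᵥ t.ofLp := by
      rw [Matrix.dotProduct_mulVec, Matrix.mulVec_transpose, Matrix.vecMul_transpose,
        ← Matrix.mulVec_transpose A, Matrix.mulVec_mulVec, hA, Matrix.one_mulVec]
    simpa [dotProduct, sq] using this
  have h3 : ∑ i, ((A.transpose.mulVec t.ofLp i : ℝ) : ℂ) ^ 2 = ∑ i, ((t.ofLp i : ℝ) : ℂ) ^ 2 := by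
    exact_mod_cast h2
  simp only [Complex.ofReal_zero, mul_zero, zero_mul, zero_sub]
  simp_rw [Finset.sum_neg_distrib, ← Finset.sum_div, ← Finset.mul_sum]
  rw [h3]

lemma neg_one_pow_bip {n : ℕ} (x y : BV n) :
    (-1 : ℝ) ^ bip x y = ∏ i, if x i && y i then (-1 : ℝ) else 1 := by
  rw [bip, Finset.prod_ite]
  simp

lemma sum_neg_one_pow_bip_mul {n : ℕ} (x y : BV n) :
    ∑ z : BV n, (-1 : ℝ) ^ bip x z * (-1 : ℝ) ^ bip y z = if x = y then 2 ^ n else 0 := by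
  have h : ∀ z : BV n, (-1 : ℝ) ^ bip x z * (-1 : ℝ) ^ bip y z =
      ∏ i, (fun i (b : Bool) => (if x i && b then (-1 : ℝ) else 1) *
        (if y i && b then (-1 : ℝ) else 1)) i (z i) := by
    intro z
    rw [neg_one_pow_bip, neg_one_pow_bip, Finset.prod_mul_distrib]
  have h' : ∀ i, ∑ b : Bool, (if x i && b then (-1 : ℝ) else 1) *
      (if y i && b then (-1 : ℝ) else 1) = if x i = y i then 2 else 0 := by
    intro i
    cases x i <;> cases y i <;> norm_num
  rw [Finset.sum_congr rfl fun z _ => h z]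
  refine (Fintype.prod_sum fun i (b : Bool) => (if x i && b then (-1 : ℝ) else 1) *
        (if y i && b then (-1 : ℝ) else 1)).symm.trans ?_
  rw [Finset.prod_congr rfl fun i _ => h' i]
  split_ifs with hxy
  · simp [hxy]
  · obtain ⟨i, hi⟩ := Function.ne_iff.mp hxy
    exact Finset.prod_eq_zero (Finset.mem_univ i) (by simp [hi])

lemma Had_mul_transpose (n : ℕ) : Had n * (Had n).transpose = 1 := by
  ext x y
  have hN : Real.sqrt (2 ^ n) * Real.sqrt (2 ^ n) = 2 ^ n := Real.mul_self_sqrt (by positivity)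
  simp only [Matrix.mul_apply, Matrix.transpose_apply, Had, Matrix.of_apply, div_mul_div_comm, hN,
    ← Finset.sum_div, sum_neg_one_pow_bip_mul, Matrix.one_apply]
  split_ifs <;> simp

lemma map_mulVec_gaussVec (C : ℝ) (n : ℕ) :
    (gaussVec C n).map (Had n).mulVec = gaussVec C n :=
  map_mulVec_pi_gaussianReal _ (Had_mul_transpose n) _

lemma abs_trnc_le (a : ℝ) : |trnc a| ≤ 1 := by
  unfold trnc
  rw [abs_le]
  exact ⟨le_min (by norm_num) (le_max_left _ _), min_le_left _ _⟩

lemma measurable_trnc : Measurable trnc := by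
  unfold trnc
  fun_prop

lemma integrable_trnc_sq_sub (μ : Measure ℝ) [IsFiniteMeasure μ] (v : ℝ) :
    Integrable (fun y : ℝ => trnc (y ^ 2 - v)) μ := by
  refine Integrable.of_bound (C := 1) ?_ (ae_of_all _ fun y => abs_trnc_le _)
  exact (measurable_trnc.comp (by fun_prop)).aestronglyMeasurable

lemma one_add_trnc_nonneg (a : ℝ) : 0 ≤ (1 + trnc a) / 2 := by
  linarith [(abs_le.mp (abs_trnc_le a)).1]

lemma one_sub_trnc_nonneg (a : ℝ) : 0 ≤ (1 - trnc a) / 2 := by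
  linarith [(abs_le.mp (abs_trnc_le a)).2]

lemma lintegral_roundM (a : ℝ) (f : ℝ → ENNReal) :
    ∫⁻ x, f x ∂(roundM a) = ENNReal.ofReal ((1 + trnc a) / 2) * f 1 +
      ENNReal.ofReal ((1 - trnc a) / 2) * f (-1) := by
  rw [roundM, lintegral_add_measure, lintegral_smul_measure, lintegral_smul_measure,
    lintegral_dirac, lintegral_dirac]
  rfl

instance isProbabilityMeasure_roundM (a : ℝ) : IsProbabilityMeasure (roundM a) := by
  constructor
  rw [← lintegral_one, lintegral_roundM, mul_one, mul_one,
    ← ENNReal.ofReal_add (one_add_trnc_nonneg a) (one_sub_trnc_nonneg a)]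
  norm_num [← add_div]

lemma measurable_roundM : Measurable roundM := by
  refine Measure.measurable_of_measurable_coe _ fun s hs => ?_
  have h : ∀ a, roundM a s = ENNReal.ofReal ((1 + trnc a) / 2) * s.indicator 1 1 +
      ENNReal.ofReal ((1 - trnc a) / 2) * s.indicator 1 (-1) := by
    intro a
    rw [← lintegral_indicator_one hs, lintegral_roundM]
  simp_rw [h]
  have := measurable_trnc
  fun_prop

lemma measurable_pi_roundM {ι : Type*} [Fintype ι] :
    Measurable fun z : ι → ℝ => Measure.pi fun i => roundM (z i) := by
  refine Measurable.measure_of_isPiSystem_of_isProbabilityMeasure generateFrom_pi.symm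
    isPiSystem_pi ?_
  rintro _ ⟨s, hs, rfl⟩
  simp_rw [Measure.pi_pi]
  refine Finset.measurable_prod _ fun i _ => ?_
  have hsi : MeasurableSet (s i) := hs i (Set.mem_univ i)
  exact (Measure.measurable_coe hsi).comp
    (measurable_roundM.comp (measurable_pi_apply i))

lemma integral_exp_sq_gaussianReal {v : NNReal} (hv : 0 < v) :
    ∫ y, Real.exp (y ^ 2 / (4 * v)) ∂(gaussianReal 0 v) = Real.sqrt 2 := by
  have hv' : (0 : ℝ) < v := by exact_mod_cast hv
  rw [integral_gaussianReal_eq_integral_smul hv.ne']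
  have h : ∀ y : ℝ, gaussianPDFReal 0 v y • Real.exp (y ^ 2 / (4 * v)) =
      (Real.sqrt (2 * Real.pi * v))⁻¹ * Real.exp (-(1 / (4 * v)) * y ^ 2) := by
    intro y
    rw [gaussianPDFReal, smul_eq_mul, mul_assoc, ← Real.exp_add]
    congr 2
    field_simp
    ring
  simp_rw [h]
  rw [integral_const_mul, integral_gaussian, ← Real.sqrt_inv, ← Real.sqrt_mul (by positivity)]
  congr 1
  field_simp
  ring

lemma integrable_exp_sq_gaussianReal {v : NNReal} (hv : 0 < v) :
    Integrable (fun y => Real.exp (y ^ 2 / (4 * v))) (gaussianReal 0 v) := by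
  by_contra h
  have := integral_undef h
  rw [integral_exp_sq_gaussianReal hv] at this
  simp at this

lemma abs_trnc_sub_le {v y : ℝ} (hv : 0 < v) (hv1 : v ≤ 1) :
    |trnc (y ^ 2 - v) - (y ^ 2 - v)| ≤
      4 * v * Real.exp (-(1 / (4 * v))) * Real.exp (y ^ 2 / (4 * v)) := by
  have h1 : max (-1) (y ^ 2 - v) = y ^ 2 - v := max_eq_right (by nlinarith [sq_nonneg y])
  rw [trnc, h1, mul_assoc, ← Real.exp_add]
  have h2 : (y ^ 2 - 1) / (4 * v) ≤ Real.exp (-(1 / (4 * v)) + y ^ 2 / (4 * v)) := by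
    have := Real.add_one_le_exp (-(1 / (4 * v)) + y ^ 2 / (4 * v))
    rw [sub_div]
    linarith
  rw [div_le_iff₀' (by positivity)] at h2
  have h3 : 0 ≤ 4 * v * Real.exp (-(1 / (4 * v)) + y ^ 2 / (4 * v)) := by positivity
  rcases min_cases 1 (y ^ 2 - v) with ⟨h, h'⟩ | ⟨h, h'⟩ <;> rw [h, abs_le] <;> constructor <;>
    linarith

/-- The mean of the truncated centred square of a Gaussian is exponentially small. -/
lemma abs_integral_trnc_le {v : ℝ} (hv : 0 < v) (hv1 : v ≤ 1 / 8) :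
    |∫ y, trnc (y ^ 2 - v) ∂(gaussianReal 0 v.toNNReal)| ≤ Real.exp (-(1 / (4 * v))) := by
  have hvn : 0 < v.toNNReal := Real.toNNReal_pos.mpr hv
  have hc : (v.toNNReal : ℝ) = v := Real.coe_toNNReal v hv.le
  have hE := integral_exp_sq_gaussianReal hvn
  have hI := integrable_exp_sq_gaussianReal hvn
  rw [hc] at hE hI
  have hsq : Integrable (fun y : ℝ => y ^ 2) (gaussianReal 0 v.toNNReal) :=
    (memLp_id_gaussianReal 2).integrable_sq
  have hmean : ∫ y, (y ^ 2 - v) ∂(gaussianReal 0 v.toNNReal) = 0 := by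
    have hvar : ∫ y, y ^ 2 ∂(gaussianReal 0 v.toNNReal) = v := by
      have := variance_fun_id_gaussianReal (μ := 0) (v := v.toNNReal)
      rw [variance_eq_integral (by fun_prop)] at this
      simpa [hc] using this
    rw [integral_sub hsq (integrable_const _), hvar]
    simp
  have htr := integrable_trnc_sq_sub (gaussianReal 0 v.toNNReal) v
  have hA : Integrable (fun y : ℝ => y ^ 2 - v) (gaussianReal 0 v.toNNReal) :=
    hsq.sub (integrable_const _)
  calc |∫ y, trnc (y ^ 2 - v) ∂(gaussianReal 0 v.toNNReal)|
      = |∫ y, (trnc (y ^ 2 - v) - (y ^ 2 - v)) ∂(gaussianReal 0 v.toNNReal)| := by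
        rw [integral_sub htr hA, hmean, sub_zero]
    _ ≤ ∫ y, |trnc (y ^ 2 - v) - (y ^ 2 - v)| ∂(gaussianReal 0 v.toNNReal) :=
        abs_integral_le_integral_abs
    _ ≤ ∫ y, 4 * v * Real.exp (-(1 / (4 * v))) * Real.exp (y ^ 2 / (4 * v))
          ∂(gaussianReal 0 v.toNNReal) :=
        integral_mono (htr.sub hA).abs (hI.const_mul _)
          fun y => abs_trnc_sub_le hv (by linarith)
    _ = 4 * v * Real.sqrt 2 * Real.exp (-(1 / (4 * v))) := by
        rw [integral_const_mul, hE]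
        ring
    _ ≤ 1 * Real.exp (-(1 / (4 * v))) := by
        have h2 : Real.sqrt 2 ≤ 2 := by
          rw [Real.sqrt_le_left (by norm_num)]
          norm_num
        have : 0 ≤ Real.sqrt 2 := Real.sqrt_nonneg 2
        gcongr
        nlinarith
    _ = Real.exp (-(1 / (4 * v))) := one_mul _

/-- The sign of a coordinate, counting everything different from `1` as `-1`. -/
def pmSign (a : ℝ) : ℝ := if a = 1 then 1 else -1

lemma measurable_pmSign : Measurable pmSign :=
  Measurable.ite (measurableSet_singleton 1) measurable_const measurable_const

lemma lintegral_exp_pmSign_roundM (l a : ℝ) :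
    ∫⁻ x, ENNReal.ofReal (Real.exp (l * pmSign x)) ∂(roundM a) =
      ENNReal.ofReal (Real.cosh l + trnc a * Real.sinh l) := by
  rw [lintegral_roundM, ← ENNReal.ofReal_mul (one_add_trnc_nonneg a),
    ← ENNReal.ofReal_mul (one_sub_trnc_nonneg a), ← ENNReal.ofReal_add]
  · congr 1
    have h : pmSign (-1) = -1 := if_neg (by norm_num)
    rw [h, pmSign, if_pos rfl, Real.cosh_eq, Real.sinh_eq, mul_one, mul_neg_one]
    ring
  · exact mul_nonneg (one_add_trnc_nonneg a) (Real.exp_nonneg _)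
  · exact mul_nonneg (one_sub_trnc_nonneg a) (Real.exp_nonneg _)

lemma abs_sinh_le_cosh (l : ℝ) : |Real.sinh l| ≤ Real.cosh l := by
  rw [Real.abs_sinh, ← Real.cosh_abs]
  exact (Real.sinh_lt_cosh _).le

lemma cosh_add_mul_sinh_nonneg {a : ℝ} (ha : |a| ≤ 1) (l : ℝ) :
    0 ≤ Real.cosh l + a * Real.sinh l := by
  have h : |a * Real.sinh l| ≤ 1 * Real.cosh l := by
    rw [abs_mul]
    exact mul_le_mul ha (abs_sinh_le_cosh l) (abs_nonneg _) zero_le_one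
  linarith [(abs_le.mp h).1]

lemma cosh_add_mul_sinh_le (a l : ℝ) :
    Real.cosh l + a * Real.sinh l ≤ Real.exp (l ^ 2 / 2 + |a|) := by
  have h : a * Real.sinh l ≤ |a| * Real.cosh l :=
    (le_abs_self _).trans (by
      rw [abs_mul]
      exact mul_le_mul_of_nonneg_left (abs_sinh_le_cosh l) (abs_nonneg a))
  calc Real.cosh l + a * Real.sinh l ≤ Real.cosh l * (|a| + 1) := by linarith
    _ ≤ Real.exp (l ^ 2 / 2) * Real.exp |a| :=
        mul_le_mul (Real.cosh_le_exp_half_sq l) (Real.add_one_le_exp _) (by positivity)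
          (Real.exp_nonneg _)
    _ = Real.exp (l ^ 2 / 2 + |a|) := (Real.exp_add _ _).symm

lemma lintegral_cosh_add_trnc_mul_sinh_le {v : ℝ} (hv : 0 < v) (hv1 : v ≤ 1 / 8) (l : ℝ) :
    ∫⁻ y, ENNReal.ofReal (Real.cosh l + trnc (y ^ 2 - v) * Real.sinh l)
      ∂(gaussianReal 0 v.toNNReal) ≤
      ENNReal.ofReal (Real.exp (l ^ 2 / 2 + Real.exp (-(1 / (4 * v))))) := by
  have htr := integrable_trnc_sq_sub (gaussianReal 0 v.toNNReal) v
  have hI : Integrable (fun y : ℝ => Real.cosh l + trnc (y ^ 2 - v) * Real.sinh l)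
      (gaussianReal 0 v.toNNReal) := (integrable_const _).add (htr.mul_const _)
  rw [← ofReal_integral_eq_lintegral_ofReal hI
    (ae_of_all _ fun y => cosh_add_mul_sinh_nonneg (abs_trnc_le _) l)]
  refine ENNReal.ofReal_le_ofReal ?_
  rw [integral_add (integrable_const _) (htr.mul_const _), integral_mul_const]
  simp only [integral_const, probReal_univ, one_smul]
  refine (cosh_add_mul_sinh_le _ l).trans (Real.exp_le_exp.mpr ?_)
  linarith [abs_integral_trnc_le hv hv1]

lemma measurable_mulVec_Had (n : ℕ) : Measurable (Had n).mulVec :=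
  (continuous_const.matrix_mulVec continuous_id : Continuous (Had n).mulVec).measurable

lemma measurable_gaussian_feature (C : ℝ) (n : ℕ) :
    Measurable fun X : BV n → ℝ =>
      (Sum.elim X fun i => ((Had n).mulVec X i) ^ 2 - eps C n : BV n ⊕ BV n → ℝ) := by
  refine measurable_pi_iff.mpr ?_
  rintro (i | i)
  · exact measurable_pi_apply i
  · exact (((measurable_pi_apply i).comp (measurable_mulVec_Had n)).pow_const 2).sub_const _

instance isProbabilityMeasure_gaussVec (C : ℝ) (n : ℕ) : IsProbabilityMeasure (gaussVec C n) := by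
  unfold gaussVec
  infer_instance

instance isProbabilityMeasure_Dmeas (C : ℝ) (n : ℕ) : IsProbabilityMeasure (Dmeas C n) := by
  have : IsProbabilityMeasure (Gmeas' C n) :=
    Measure.isProbabilityMeasure_map (measurable_gaussian_feature C n).aemeasurable
  exact isProbabilityMeasure_bind measurable_pi_roundM.aemeasurable
    (ae_of_all _ fun z => inferInstance)

lemma measurable_exp_sum_pmSign (n : ℕ) (l : ℝ) :
    Measurable fun z : BV n ⊕ BV n → ℝ =>
      ENNReal.ofReal (Real.exp (l * ∑ i : BV n, pmSign (z (Sum.inr i)))) := by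
  have h : Measurable fun z : BV n ⊕ BV n → ℝ => ∑ i : BV n, pmSign (z (Sum.inr i)) :=
    Finset.measurable_sum _ fun _ _ => measurable_pmSign.comp (measurable_pi_apply _)
  exact (Real.measurable_exp.comp (h.const_mul l)).ennreal_ofReal

lemma lintegral_exp_sum_pmSign_pi_roundM {n : ℕ} (l : ℝ) (z : BV n ⊕ BV n → ℝ) :
    ∫⁻ w, ENNReal.ofReal (Real.exp (l * ∑ i : BV n, pmSign (w (Sum.inr i))))
      ∂(Measure.pi fun i => roundM (z i)) =
      ∏ i : BV n, ENNReal.ofReal (Real.cosh l + trnc (z (Sum.inr i)) * Real.sinh l) := by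
  let f : BV n ⊕ BV n → ℝ → ENNReal :=
    Sum.elim (fun _ _ => 1) fun _ x => ENNReal.ofReal (Real.exp (l * pmSign x))
  have hf : ∀ i, Measurable (f i) := by
    have := measurable_pmSign
    rintro (i | i)
    · exact measurable_const
    · change Measurable fun x => ENNReal.ofReal (Real.exp (l * pmSign x))
      fun_prop
  have h : ∀ w : BV n ⊕ BV n → ℝ,
      ENNReal.ofReal (Real.exp (l * ∑ i : BV n, pmSign (w (Sum.inr i)))) = ∏ i, f i (w i) := by
    intro w
    rw [Fintype.prod_sum_type, Finset.mul_sum, Real.exp_sum,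
      ENNReal.ofReal_prod_of_nonneg fun _ _ => Real.exp_nonneg _]
    simp [f]
  simp_rw [h]
  rw [lintegral_pi_prod _ f hf, Fintype.prod_sum_type]
  simp [f, lintegral_exp_pmSign_roundM]

lemma lintegral_exp_sum_pmSign_Dmeas_le {C : ℝ} {n : ℕ} (hv : 0 < eps C n)
    (hv1 : eps C n ≤ 1 / 8) (l : ℝ) :
    ∫⁻ w, ENNReal.ofReal (Real.exp (l * ∑ i : BV n, pmSign (w (Sum.inr i)))) ∂(Dmeas C n) ≤
      ENNReal.ofReal (Real.exp (2 ^ n * (l ^ 2 / 2 + Real.exp (-(1 / (4 * eps C n)))))) := by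
  have hg : Measurable fun y : ℝ =>
      ENNReal.ofReal (Real.cosh l + trnc (y ^ 2 - eps C n) * Real.sinh l) := by
    have := measurable_trnc
    fun_prop
  have hG : Measurable fun z : BV n ⊕ BV n → ℝ =>
      ∏ i : BV n, ENNReal.ofReal (Real.cosh l + trnc (z (Sum.inr i)) * Real.sinh l) := by
    have := measurable_trnc
    fun_prop
  rw [Dmeas, Measure.lintegral_bind measurable_pi_roundM.aemeasurable
    (measurable_exp_sum_pmSign n l).aemeasurable]
  simp_rw [lintegral_exp_sum_pmSign_pi_roundM]
  rw [Gmeas', lintegral_map hG (measurable_gaussian_feature C n)]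
  simp only [Sum.elim_inr]
  have hP : Measurable fun Y : BV n → ℝ => ∏ i : BV n,
      ENNReal.ofReal (Real.cosh l + trnc ((Y i) ^ 2 - eps C n) * Real.sinh l) :=
    Finset.measurable_prod _ fun i _ => hg.comp (measurable_pi_apply i)
  rw [← lintegral_map hP (measurable_mulVec_Had n), map_mulVec_gaussVec, gaussVec,
    lintegral_pi_prod _ (fun _ y =>
      ENNReal.ofReal (Real.cosh l + trnc (y ^ 2 - eps C n) * Real.sinh l)) fun _ => hg]
  refine (Finset.prod_le_prod' fun i _ =>
    lintegral_cosh_add_trnc_mul_sinh_le hv hv1 l).trans_eq ?_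
  rw [Finset.prod_const, ← ENNReal.ofReal_pow (Real.exp_nonneg _), ← Real.exp_nat_mul]
  simp

/-- Chernoff bound for the sum of the rounded coordinates, in either direction. -/
lemma Dmeas_tail_le {C : ℝ} {n : ℕ} (hv : 0 < eps C n) (hv1 : eps C n ≤ 1 / 8) (l t : ℝ) :
    (Dmeas C n).real {w | t ≤ l * ∑ i : BV n, pmSign (w (Sum.inr i))} ≤
      Real.exp (2 ^ n * (l ^ 2 / 2 + Real.exp (-(1 / (4 * eps C n)))) - t) := by
  have h := meas_ge_le_lintegral_div (μ := Dmeas C n)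
    (f := fun w => ENNReal.ofReal (Real.exp (l * ∑ i : BV n, pmSign (w (Sum.inr i)))))
    (measurable_exp_sum_pmSign n l).aemeasurable (ε := ENNReal.ofReal (Real.exp t))
    (by simp [Real.exp_pos]) ENNReal.ofReal_ne_top
  have hset : {w : BV n ⊕ BV n → ℝ | t ≤ l * ∑ i : BV n, pmSign (w (Sum.inr i))} =
      {w | ENNReal.ofReal (Real.exp t) ≤
        ENNReal.ofReal (Real.exp (l * ∑ i : BV n, pmSign (w (Sum.inr i))))} := by
    ext w
    rw [Set.mem_ofPred_eq, Set.mem_ofPred_eq, ENNReal.ofReal_le_ofReal_iff (Real.exp_nonneg _),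
      Real.exp_le_exp]
  rw [hset, Measure.real]
  refine ENNReal.toReal_le_of_le_ofReal (Real.exp_nonneg _) (h.trans ?_)
  rw [Real.exp_sub, ENNReal.ofReal_div_of_pos (Real.exp_pos _)]
  gcongr
  exact lintegral_exp_sum_pmSign_Dmeas_le hv hv1 l

lemma sum_pmSign_eq {ι : Type*} [Fintype ι] (y : ι → ℝ) :
    ∑ i, pmSign (y i) = 2 * ((Finset.univ.filter fun i => y i = 1).card : ℝ) - Fintype.card ι := by
  have h : ∀ i, pmSign (y i) = 2 * (if y i = 1 then 1 else 0) - 1 := by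
    intro i
    unfold pmSign
    split_ifs <;> norm_num
  simp_rw [h]
  rw [Finset.sum_sub_distrib, ← Finset.mul_sum, Finset.sum_boole]
  simp

lemma tendsto_two_pow_rpow_third :
    Filter.Tendsto (fun n : ℕ => ((2 : ℝ) ^ n) ^ ((1 : ℝ) / 3)) Filter.atTop Filter.atTop :=
  (tendsto_rpow_atTop (by norm_num)).comp (tendsto_pow_atTop_atTop_of_one_lt (by norm_num))

lemma eventually_exp_le :
    ∀ᶠ u : ℝ in Filter.atTop, Real.exp (1 - u / 2) ≤ 5 / 2 / u ^ 6 := by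
  have h := (Real.tendsto_pow_mul_exp_neg_atTop_nhds_zero 6).comp
    (Filter.tendsto_id.atTop_div_const (show (0 : ℝ) < 2 by norm_num))
  have hpos : (0 : ℝ) < 5 / (128 * Real.exp 1) := by positivity
  filter_upwards [h.eventually_le_const hpos, Filter.eventually_gt_atTop 0] with u hu hu0
  simp only [Function.comp_apply, id_eq] at hu
  rw [le_div_iff₀ (by positivity)] at hu ⊢
  rw [sub_eq_add_neg, Real.exp_add]
  linarith

lemma eps_pos {C : ℝ} (hC : 20 ≤ C) {n : ℕ} (hn : 1 ≤ n) : 0 < eps C n := by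
  have : 0 < Real.log (2 ^ n) := Real.log_pos (one_lt_pow₀ (by norm_num) (by omega))
  unfold eps
  positivity

lemma log_two_pow_ge {n : ℕ} (hn : 1 ≤ n) : 1 / 2 ≤ Real.log (2 ^ n) := by
  rw [Real.log_pow]
  have h1 : (1 : ℝ) ≤ n := by exact_mod_cast hn
  nlinarith [Real.log_two_gt_d9]

lemma eps_le {C : ℝ} (hC : 20 ≤ C) {n : ℕ} (hn : 1 ≤ n) : eps C n ≤ 1 / 8 := by
  have := log_two_pow_ge hn
  unfold eps
  exact one_div_le_one_div_of_le (by norm_num) (by nlinarith)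

lemma exp_neg_inv_eps_le {C : ℝ} (hC : 20 ≤ C) {n : ℕ} (hn : 1 ≤ n) :
    Real.exp (-(1 / (4 * eps C n))) ≤ 1 / 2 ^ n := by
  have h := log_two_pow_ge hn
  have h1 : 1 / (4 * eps C n) = C * Real.log (2 ^ n) / 4 := by
    unfold eps
    field_simp
  rw [h1, one_div, ← Real.exp_log (show (0 : ℝ) < 2 ^ n by positivity), ← Real.exp_neg,
    Real.log_exp]
  exact Real.exp_le_exp.mpr (by nlinarith)

/-- There exists a constant `C₀ ≥ 20` such that for every `C ≥ C₀` and all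
sufficiently large `N`: for `(X, Y) ~ D` (with `Y` the last `N` coordinates) and
`δ = N^{-1/3}`, with probability at least `1 - 5 N⁻²`,
`(1-δ) N/2 ≤ |{i : Y_i = 1}| ≤ (1+δ) N/2`. -/
theorem stmt15 :
    ∃ C₀ : ℝ, 20 ≤ C₀ ∧
      ∀ C : ℝ, C₀ ≤ C → ∃ n₀ : ℕ, ∀ n : ℕ, n₀ ≤ n →
        1 - 5 / (2 ^ n : ℝ) ^ 2 ≤
          ((Dmeas C n) {z |
            (1 - ((2 : ℝ) ^ n) ^ (-(1 : ℝ) / 3)) * 2 ^ n / 2 ≤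
              ((Finset.univ.filter fun i : BV n => z (Sum.inr i) = 1).card : ℝ) ∧
            ((Finset.univ.filter fun i : BV n => z (Sum.inr i) = 1).card : ℝ) ≤
              (1 + ((2 : ℝ) ^ n) ^ (-(1 : ℝ) / 3)) * 2 ^ n / 2}).toReal := by
  refine ⟨20, le_rfl, fun C hC => ?_⟩
  obtain ⟨n₀, hn₀⟩ := Filter.eventually_atTop.mp
    (tendsto_two_pow_rpow_third.eventually eventually_exp_le)
  refine ⟨max n₀ 1, fun n hn => ?_⟩
  have hn1 : 1 ≤ n := (le_max_right _ _).trans hn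
  have hexp := hn₀ n ((le_max_left _ _).trans hn)
  have hN : (0 : ℝ) < 2 ^ n := by positivity
  set d : ℝ := ((2 : ℝ) ^ n) ^ (-(1 : ℝ) / 3) with hd
  set u : ℝ := ((2 : ℝ) ^ n) ^ ((1 : ℝ) / 3) with hu
  have hu6 : u ^ 6 = (2 ^ n : ℝ) ^ 2 := by
    rw [hu, ← Real.rpow_natCast, ← Real.rpow_mul hN.le, ← Real.rpow_natCast (2 ^ n : ℝ) 2]
    norm_num
  have hd2 : 2 ^ n * d ^ 2 = u := by
    rw [hd, hu, ← Real.rpow_natCast _ 2, ← Real.rpow_mul hN.le]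
    nth_rewrite 1 [← Real.rpow_one ((2 : ℝ) ^ n)]
    rw [← Real.rpow_add hN]
    norm_num
  have hd0 : 0 < d := Real.rpow_pos_of_pos hN _
  rw [hu6] at hexp
  have htail : ∀ l : ℝ, l ^ 2 = d ^ 2 →
      (Dmeas C n).real {w | u ≤ l * ∑ i : BV n, pmSign (w (Sum.inr i))} ≤
        5 / 2 / (2 ^ n : ℝ) ^ 2 := by
    intro l hl
    refine (Dmeas_tail_le (eps_pos hC hn1) (eps_le hC hn1) l u).trans
      ((Real.exp_le_exp.mpr ?_).trans hexp)
    have h1 : 2 ^ n * Real.exp (-(1 / (4 * eps C n))) ≤ 1 := by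
      have := mul_le_mul_of_nonneg_left (exp_neg_inv_eps_le hC hn1) hN.le
      rwa [mul_one_div_cancel hN.ne'] at this
    rw [hl]
    linarith
  set S : Set (BV n ⊕ BV n → ℝ) := {z |
    (1 - d) * 2 ^ n / 2 ≤ ((Finset.univ.filter fun i : BV n => z (Sum.inr i) = 1).card : ℝ) ∧
    ((Finset.univ.filter fun i : BV n => z (Sum.inr i) = 1).card : ℝ) ≤
      (1 + d) * 2 ^ n / 2} with hSdef
  change _ ≤ (Dmeas C n).real S
  have hcover : Set.univ ⊆ S ∪
      ({w | u ≤ d * ∑ i : BV n, pmSign (w (Sum.inr i))} ∪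
        {w | u ≤ -d * ∑ i : BV n, pmSign (w (Sum.inr i))}) := by
    intro w _
    by_contra hw
    simp only [Set.mem_union, Set.mem_ofPred_eq, not_or, not_le] at hw
    obtain ⟨hwS, hw1, hw2⟩ := hw
    apply hwS
    rw [sum_pmSign_eq fun i : BV n => w (Sum.inr i)] at hw1 hw2
    have hcard : ((Fintype.card (BV n) : ℕ) : ℝ) = 2 ^ n := by simp
    rw [hcard, ← hd2] at hw1 hw2
    have h1 := lt_of_mul_lt_mul_left (hw1.trans_eq (by ring : _ = d * (d * 2 ^ n))) hd0.le
    have h2 : d * -(2 * ((Finset.univ.filter fun i : BV n => w (Sum.inr i) = 1).card : ℝ)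
        - 2 ^ n) < d * (d * 2 ^ n) := by linarith
    have h3 := lt_of_mul_lt_mul_left h2 hd0.le
    constructor <;> linarith
  have hle := (measureReal_mono (μ := Dmeas C n) hcover).trans
    ((measureReal_union_le _ _).trans (add_le_add_right (measureReal_union_le _ _) _))
  rw [probReal_univ] at hle
  have h1 := htail d rfl
  have h2 := htail (-d) (by ring)
  have h5 : 5 / (2 ^ n : ℝ) ^ 2 = 5 / 2 / (2 ^ n : ℝ) ^ 2 + 5 / 2 / (2 ^ n : ℝ) ^ 2 := by ring
  linarith
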